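/- arXiv:math/0012073 — 2 statements merged into one kernel-verified Lean document; each statement's English description precedes it below -/
import Mathlib

section
/- Let H be a finite dimensional Hopf π-coalgebra over a field k. Then the antipode of H is bijective, i.e., each S_α : H_α → H_{α⁻¹} is a k-linear bijection. -/
open scoped TensorProduct

noncomputable section

/-- Transport of the algebra structure along an equality of group indices. -/
def gcast (k : Type*) [CommSemiring k] {π : Type*} (H : π → Type*)
    [∀ α, Ring (H α)] [∀ α, Algebra k (H α)] {a b : π} (h : a = b) :
    H a ≃ₐ[k] H b := by subst h; exact AlgEquiv.refl

/-- Transport of a module family along an equality of group indices. -/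
def fcast (k : Type*) [CommSemiring k] {π : Type*} (M : π → Type*)
    [∀ α, AddCommGroup (M α)] [∀ α, Module k (M α)] {a b : π} (h : a = b) :
    M a ≃ₗ[k] M b := by subst h; exact LinearEquiv.refl k (M a)

/-- A Hopf `π`-coalgebra (in the sense of Turaev/Virelizier) over a field `k`:
a family of `k`-algebras `H α` with comultiplication `Δ`, counit `ε` and antipode `S`. -/
class HopfGCoalgebra (k : Type*) [Field k] {π : Type*} [Group π]
    (H : π → Type*) [∀ α, Ring (H α)] [∀ α, Algebra k (H α)] where
  Δ : ∀ α β : π, H (α * β) →ₐ[k] H α ⊗[k] H β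
  ε : H (1 : π) →ₐ[k] k
  S : ∀ α : π, H α →ₗ[k] H α⁻¹
  coassoc : ∀ α β γ : π,
    (TensorProduct.assoc k (H α) (H β) (H γ)).toLinearMap ∘ₗ
        (TensorProduct.map (Δ α β).toLinearMap (LinearMap.id : H γ →ₗ[k] H γ)) ∘ₗ
        (Δ (α * β) γ).toLinearMap
      = (TensorProduct.map (LinearMap.id : H α →ₗ[k] H α) (Δ β γ).toLinearMap) ∘ₗ
        (Δ α (β * γ)).toLinearMap ∘ₗ (gcast k H (mul_assoc α β γ)).toLinearMap
  counit_right : ∀ α : π,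
    (TensorProduct.rid k (H α)).toLinearMap ∘ₗ
        (TensorProduct.map (LinearMap.id : H α →ₗ[k] H α) ε.toLinearMap) ∘ₗ
        (Δ α 1).toLinearMap ∘ₗ (gcast k H (mul_one α).symm).toLinearMap = LinearMap.id
  counit_left : ∀ α : π,
    (TensorProduct.lid k (H α)).toLinearMap ∘ₗ
        (TensorProduct.map ε.toLinearMap (LinearMap.id : H α →ₗ[k] H α)) ∘ₗ
        (Δ 1 α).toLinearMap ∘ₗ (gcast k H (one_mul α).symm).toLinearMap = LinearMap.id
  antipode_left : ∀ α : π,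
    (LinearMap.mul' k (H α)) ∘ₗ
        (TensorProduct.map ((gcast k H (inv_inv α)).toLinearMap ∘ₗ S α⁻¹)
          (LinearMap.id : H α →ₗ[k] H α)) ∘ₗ (Δ α⁻¹ α).toLinearMap
      = (Algebra.linearMap k (H α)) ∘ₗ ε.toLinearMap ∘ₗ
        (gcast k H (inv_mul_cancel α)).toLinearMap
  antipode_right : ∀ α : π,
    (LinearMap.mul' k (H α)) ∘ₗ
        (TensorProduct.map (LinearMap.id : H α →ₗ[k] H α)
          ((gcast k H (inv_inv α)).toLinearMap ∘ₗ S α⁻¹)) ∘ₗ (Δ α α⁻¹).toLinearMap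
      = (Algebra.linearMap k (H α)) ∘ₗ ε.toLinearMap ∘ₗ
        (gcast k H (mul_inv_cancel α)).toLinearMap

namespace HopfGCoalgebra

variable (k : Type*) [Field k] {π : Type*} [Group π] (H : π → Type*)
  [∀ α, Ring (H α)] [∀ α, Algebra k (H α)] [HopfGCoalgebra k H]

/-- A left `π`-integral for `H`. -/
def IsLeftIntegral (lam : ∀ α : π, H α →ₗ[k] k) : Prop :=
  ∀ (α β : π) (x : H (α * β)),
    (TensorProduct.rid k (H α))
        (TensorProduct.map (LinearMap.id : H α →ₗ[k] H α) (lam β) (Δ α β x))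
      = lam (α * β) x • (1 : H α)

/-- A right `π`-integral for `H`. -/
def IsRightIntegral (lam : ∀ α : π, H α →ₗ[k] k) : Prop :=
  ∀ (α β : π) (x : H (α * β)),
    (TensorProduct.lid k (H β))
        (TensorProduct.map (lam α) (LinearMap.id : H β →ₗ[k] H β) (Δ α β x))
      = lam (α * β) x • (1 : H β)

/-- A `π`-grouplike element of `H`. -/
def IsGrouplike (g : ∀ α : π, H α) : Prop :=
  (∀ α β : π, Δ α β (g (α * β)) = g α ⊗ₜ[k] g β) ∧ ε (k := k) (H := H) (g 1) = 1

/-- `g` is the distinguished `π`-grouplike element of `H`. -/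
def IsDistinguishedGrouplike (g : ∀ α : π, H α) : Prop :=
  IsGrouplike k H g ∧
    ∀ lam : ∀ α : π, H α →ₗ[k] k, IsRightIntegral k H lam →
      ∀ (α β : π) (x : H (α * β)),
        (TensorProduct.rid k (H α))
            (TensorProduct.map (LinearMap.id : H α →ₗ[k] H α) (lam β) (Δ α β x))
          = lam (α * β) x • g α

/-- `ν` is the distinguished grouplike element of `H₁*`. -/
def IsDistinguishedNu (ν : H (1 : π) →ₐ[k] k) : Prop :=
  ∀ Λ : H (1 : π), (∀ x : H (1 : π), x * Λ = ε (k := k) (H := H) x • Λ) →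
    ∀ x : H (1 : π), Λ * x = ν x • Λ

/-- The right action `a ↼ f` of `f ∈ H₁*` on `a ∈ H α`. -/
def hitR (f : H (1 : π) →ₗ[k] k) {α : π} (a : H α) : H α :=
  (TensorProduct.lid k (H α))
    (TensorProduct.map f (LinearMap.id : H α →ₗ[k] H α)
      (Δ 1 α ((gcast k H (one_mul α).symm) a)))

/-- The left action `f ⇀ a` of `f ∈ H₁*` on `a ∈ H α`. -/
def hitL (f : H (1 : π) →ₗ[k] k) {α : π} (a : H α) : H α :=
  (TensorProduct.rid k (H α))
    (TensorProduct.map (LinearMap.id : H α →ₗ[k] H α) f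
      (Δ α 1 ((gcast k H (mul_one α).symm) a)))


/-- The comultiplication, with all arguments explicit. -/
def comul (α β : π) : H (α * β) →ₐ[k] H α ⊗[k] H β := Δ α β

/-- The counit, with all arguments explicit. -/
def counit : H (1 : π) →ₐ[k] k := ε

/-- The antipode, with all arguments explicit. -/
def antipode (α : π) : H α →ₗ[k] H α⁻¹ := S α

end HopfGCoalgebra

open HopfGCoalgebra
/-- A right Hopf `π`-comodule over `H`. -/
class HopfGComodule (k : Type*) [Field k] {π : Type*} [Group π]
    (H : π → Type*) [∀ α, Ring (H α)] [∀ α, Algebra k (H α)] [HopfGCoalgebra k H]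
    (M : π → Type*) [∀ α, AddCommGroup (M α)] [∀ α, Module k (M α)] where
  ρ : ∀ α β : π, M (α * β) →ₗ[k] M α ⊗[k] H β
  ρ_coassoc : ∀ α β γ : π,
    (TensorProduct.assoc k (M α) (H β) (H γ)).toLinearMap ∘ₗ
        (TensorProduct.map (ρ α β) (LinearMap.id : H γ →ₗ[k] H γ)) ∘ₗ (ρ (α * β) γ)
      = (TensorProduct.map (LinearMap.id : M α →ₗ[k] M α) (Δ β γ).toLinearMap) ∘ₗ
        (ρ α (β * γ)) ∘ₗ (fcast k M (mul_assoc α β γ)).toLinearMap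
  ρ_counit : ∀ α : π,
    (TensorProduct.rid k (M α)).toLinearMap ∘ₗ
        (TensorProduct.map (LinearMap.id : M α →ₗ[k] M α)
          (ε (k := k) (H := H)).toLinearMap) ∘ₗ
        (ρ α 1) ∘ₗ (fcast k M (mul_one α).symm).toLinearMap = LinearMap.id
  act : ∀ α : π, M α →ₗ[k] H α →ₗ[k] M α
  act_one : ∀ (α : π) (m : M α), act α m 1 = m
  act_mul : ∀ (α : π) (m : M α) (a b : H α), act α (act α m a) b = act α m (a * b)
  ρ_act : ∀ (α β : π) (m : M (α * β)) (a : H (α * β)),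
    ρ α β (act (α * β) m a)
      = TensorProduct.map (TensorProduct.lift (act α)) (LinearMap.mul' k (H β))
          ((TensorProduct.tensorTensorTensorComm k (M α) (H β) (H α) (H β))
            (ρ α β m ⊗ₜ[k] (Δ α β a)))

namespace HopfGComodule

variable (k : Type*) [Field k] {π : Type*} [Group π] (H : π → Type*)
  [∀ α, Ring (H α)] [∀ α, Algebra k (H α)] [HopfGCoalgebra k H]
  (M : π → Type*) [∀ α, AddCommGroup (M α)] [∀ α, Module k (M α)] [HopfGComodule k H M]

/-- The submodule of coinvariant families of `H` on `M`. -/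
def coinvFam : Submodule k (∀ α, M α) where
  carrier := {m | ∀ α β : π, ρ (H := H) α β (m (α * β)) = m α ⊗ₜ[k] (1 : H β)}
  add_mem' := by
    intro a b ha hb α β
    simp only [Pi.add_apply, map_add, ha α β, hb α β, TensorProduct.add_tmul]
  zero_mem' := by
    intro α β
    simp only [Pi.zero_apply, map_zero, TensorProduct.zero_tmul]
  smul_mem' := by
    intro c a ha α β
    simp only [Pi.smul_apply, map_smul, ha α β, TensorProduct.smul_tmul']

/-- The `α`-component of the `π`-subcomodule of coinvariants. -/
def coinvSub (α : π) : Submodule k (M α) :=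
  (coinvFam k H M).map (LinearMap.proj α : (∀ γ, M γ) →ₗ[k] M α)


/-- The comodule structure maps, with all arguments explicit. -/
def coact (α β : π) : M (α * β) →ₗ[k] M α ⊗[k] H β := ρ α β

/-- The right `H α`-action on `M α`, with all arguments explicit. -/
def hact (α : π) : M α →ₗ[k] H α →ₗ[k] M α := act α

end HopfGComodule

section Cosemisimple

variable (k : Type*) [Field k] {π : Type*} [Group π] (H : π → Type*)
  [∀ α, Ring (H α)] [∀ α, Algebra k (H α)]
  (M : π → Type*) [∀ α, AddCommGroup (M α)] [∀ α, Module k (M α)]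

/-- `N` is a `π`-subcomodule of the right `π`-comodule `(M, ρ)` over `H`. -/
def IsGSubcomodule (ρ : ∀ α β : π, M (α * β) →ₗ[k] M α ⊗[k] H β)
    (N : ∀ α, Submodule k (M α)) : Prop :=
  ∀ (α β : π), ∀ x ∈ N (α * β),
    ρ α β x ∈ LinearMap.range
      (TensorProduct.map (N α).subtype (LinearMap.id : H β →ₗ[k] H β))

/-- `N` is a simple `π`-subcomodule of `(M, ρ)`. -/
def IsSimpleGSubcomodule (ρ : ∀ α β : π, M (α * β) →ₗ[k] M α ⊗[k] H β)
    (N : ∀ α, Submodule k (M α)) : Prop :=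
  IsGSubcomodule k H M ρ N ∧ (∃ α, N α ≠ ⊥) ∧
    ∀ P : ∀ α, Submodule k (M α), IsGSubcomodule k H M ρ P → (∀ α, P α ≤ N α) →
      (∀ α, P α = ⊥) ∨ P = N

/-- The right `π`-comodule `(M, ρ)` is cosemisimple: it is the sum of its simple
`π`-subcomodules. -/
def IsGCosemisimple (ρ : ∀ α β : π, M (α * β) →ₗ[k] M α ⊗[k] H β) : Prop :=
  ∀ α : π,
    (⨆ N : {N : ∀ γ, Submodule k (M γ) // IsSimpleGSubcomodule k H M ρ N}, N.1 α) = ⊤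

end Cosemisimple

section CoalgCosemisimple

variable (k : Type*) [Field k] (C : Type*) [AddCommGroup C] [Module k C]

/-- `N` is a subcomodule of the coalgebra `(C, δ)` viewed as a right comodule over itself. -/
def IsSubcoideal (δ : C →ₗ[k] C ⊗[k] C) (N : Submodule k C) : Prop :=
  ∀ x ∈ N, δ x ∈ LinearMap.range (TensorProduct.map N.subtype (LinearMap.id : C →ₗ[k] C))

def IsSimpleSubcoideal (δ : C →ₗ[k] C ⊗[k] C) (N : Submodule k C) : Prop :=
  IsSubcoideal k C δ N ∧ N ≠ ⊥ ∧
    ∀ P : Submodule k C, IsSubcoideal k C δ P → P ≤ N → P = ⊥ ∨ P = N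

/-- The coalgebra `(C, δ)` is cosemisimple. -/
def IsCosemisimpleCoalgebra (δ : C →ₗ[k] C ⊗[k] C) : Prop :=
  (⨆ N : {N : Submodule k C // IsSimpleSubcoideal k C δ N}, N.1) = ⊤

end CoalgCosemisimple
/-- A crossed Hopf `π`-coalgebra: a Hopf `π`-coalgebra with a crossing `φ`. -/
class CrossedHopfGCoalgebra (k : Type*) [Field k] {π : Type*} [Group π]
    (H : π → Type*) [∀ α, Ring (H α)] [∀ α, Algebra k (H α)]
    extends HopfGCoalgebra k H where
  φ : ∀ β α : π, H α ≃ₐ[k] H (β * α * β⁻¹)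
  φ_comul : ∀ β α γ : π,
    (TensorProduct.map (φ β α).toLinearMap (φ β γ).toLinearMap) ∘ₗ (Δ α γ).toLinearMap
      = (Δ (β * α * β⁻¹) (β * γ * β⁻¹)).toLinearMap ∘ₗ
        (gcast k H (show β * (α * γ) * β⁻¹ = (β * α * β⁻¹) * (β * γ * β⁻¹) by
          group)).toLinearMap ∘ₗ (φ β (α * γ)).toLinearMap
  φ_counit : ∀ (β : π) (x : H (1 : π)),
    ε ((gcast k H (show β * 1 * β⁻¹ = (1 : π) by group)) (φ β 1 x)) = ε x
  φ_mul : ∀ (β β' α : π) (x : H α),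
    (gcast k H (show β * (β' * α * β'⁻¹) * β⁻¹ = (β * β') * α * (β * β')⁻¹ by group))
        (φ β (β' * α * β'⁻¹) (φ β' α x))
      = φ (β * β') α x


namespace CrossedHopfGCoalgebra

variable (k : Type*) [Field k] {π : Type*} [Group π] (H : π → Type*)
  [∀ α, Ring (H α)] [∀ α, Algebra k (H α)] [CrossedHopfGCoalgebra k H]

/-- The crossing, with all arguments explicit. -/
def crossing (β α : π) : H α ≃ₐ[k] H (β * α * β⁻¹) := φ β α

end CrossedHopfGCoalgebra

open CrossedHopfGCoalgebra

/-- A quasitriangular Hopf `π`-coalgebra: a crossed Hopf `π`-coalgebra with an R-matrix. -/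
class QTHopfGCoalgebra (k : Type*) [Field k] {π : Type*} [Group π]
    (H : π → Type*) [∀ α, Ring (H α)] [∀ α, Algebra k (H α)]
    extends CrossedHopfGCoalgebra k H where
  Rm : ∀ α β : π, H α ⊗[k] H β
  Rm_isUnit : ∀ α β : π, IsUnit (Rm α β)
  Rm_comul : ∀ (α β : π) (x : H (α * β)),
    Rm α β * Δ α β x
      = (TensorProduct.comm k (H β) (H α))
          ((TensorProduct.map
              ((gcast k H (show α⁻¹ * (α * β * α⁻¹) * α⁻¹⁻¹ = β by group)).toLinearMap ∘ₗ
                (φ α⁻¹ (α * β * α⁻¹)).toLinearMap)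
              (LinearMap.id : H α →ₗ[k] H α))
            ((Δ (α * β * α⁻¹) α)
              ((gcast k H (show α * β = (α * β * α⁻¹) * α by group)) x))) * Rm α β
  Rm_delta_right : ∀ α β γ : π,
    TensorProduct.map (LinearMap.id : H α →ₗ[k] H α) (Δ β γ).toLinearMap (Rm α (β * γ))
      = (TensorProduct.map (LinearMap.id : H α →ₗ[k] H α)
            (TensorProduct.mk k (H β) (H γ) 1) (Rm α γ))
        * (TensorProduct.map (LinearMap.id : H α →ₗ[k] H α)
            ((TensorProduct.mk k (H β) (H γ)).flip 1) (Rm α β))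
  Rm_delta_left : ∀ α β γ : π,
    (TensorProduct.assoc k (H α) (H β) (H γ))
        (TensorProduct.map (Δ α β).toLinearMap (LinearMap.id : H γ →ₗ[k] H γ)
          (Rm (α * β) γ))
      = (TensorProduct.map (LinearMap.id : H α →ₗ[k] H α)
            (TensorProduct.mk k (H β) (H γ) 1)
            (TensorProduct.map (LinearMap.id : H α →ₗ[k] H α)
              ((gcast k H (show β⁻¹ * (β * γ * β⁻¹) * β⁻¹⁻¹ = γ by group)).toLinearMap ∘ₗ
                (φ β⁻¹ (β * γ * β⁻¹)).toLinearMap)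
              (Rm α (β * γ * β⁻¹))))
        * (TensorProduct.mk k (H α) (H β ⊗[k] H γ) 1 (Rm β γ))
  Rm_phi : ∀ β α γ : π,
    TensorProduct.map (φ β α).toLinearMap (φ β γ).toLinearMap (Rm α γ)
      = Rm (β * α * β⁻¹) (β * γ * β⁻¹)

namespace QTHopfGCoalgebra

variable (k : Type*) [Field k] {π : Type*} [Group π] (H : π → Type*)
  [∀ α, Ring (H α)] [∀ α, Algebra k (H α)] [QTHopfGCoalgebra k H]

/-- The square of the antipode `S_{α⁻¹} ∘ S_α : H α → H α`. -/
def antipodeSq (α : π) : H α →ₗ[k] H α :=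
  (gcast k H (inv_inv α)).toLinearMap ∘ₗ S α⁻¹ ∘ₗ S α

/-- The map `S_{α⁻¹} ∘ φ_α : H (α⁻¹) → H α`. -/
def sphi (α : π) : H α⁻¹ →ₗ[k] H α :=
  (gcast k H (inv_inv α)).toLinearMap ∘ₗ S α⁻¹ ∘ₗ
    (gcast k H (show α * α⁻¹ * α⁻¹ = α⁻¹ by group)).toLinearMap ∘ₗ
    (φ α α⁻¹).toLinearMap

/-- The Drinfeld element `u_α = m_α ∘ (S_{α⁻¹}φ_α ⊗ id) ∘ σ_{α,α⁻¹} (R_{α,α⁻¹})`. -/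
def drinfeld (α : π) : H α :=
  LinearMap.mul' k (H α)
    (TensorProduct.map (sphi k H α) (LinearMap.id : H α →ₗ[k] H α)
      ((TensorProduct.comm k (H α) (H α⁻¹)) (Rm α α⁻¹)))

/-- The element `S_{α⁻¹}(u_{α⁻¹}) ∈ H α`. -/
def sdrinfeld (α : π) : H α :=
  (gcast k H (inv_inv α)) (S (k := k) (H := H) α⁻¹ (drinfeld k H α⁻¹))

/-- The `π`-grouplike element `ℓ_α = S_{α⁻¹}(u_{α⁻¹})⁻¹ u_α`. -/
def ell (α : π) : H α :=
  Ring.inverse (sdrinfeld k H α) * drinfeld k H α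


/-- The R-matrix, with all arguments explicit. -/
def rmatrix (α β : π) : H α ⊗[k] H β := Rm α β

end QTHopfGCoalgebra

open QTHopfGCoalgebra

namespace HopfGCoalgebra

lemma gcast_gcast_symm {k : Type*} [CommSemiring k] {π : Type*} {H : π → Type*}
    [∀ α, Ring (H α)] [∀ α, Algebra k (H α)] {a b : π} (h : a = b) (x : H b) :
    gcast k H h (gcast k H h.symm x) = x := by
  subst h
  rfl

section Convolution

variable {k : Type*} [Field k] {π : Type*} [Group π] {H : π → Type*}
  [∀ α, Ring (H α)] [∀ α, Algebra k (H α)] [HopfGCoalgebra k H]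
  {R : Type*} [Ring R] [Algebra k R] {R' : Type*} [Ring R'] [Algebra k R']

variable (k H) in
/-- The comultiplication `H c → H a ⊗ H b`, for any indices with `a * b = c`. -/
def comulOf {a b c : π} (h : a * b = c) : H c →ₐ[k] H a ⊗[k] H b :=
  (Δ a b).comp (gcast k H h.symm).toAlgHom

variable (k H) in
/-- The antipode `H a → H b`, for any indices with `a * b = 1`. -/
def antipodeOf {a b : π} (h : a * b = 1) : H a →ₗ[k] H b :=
  (gcast k H (inv_eq_of_mul_eq_one_right h)).toLinearMap ∘ₗ S a

/-- The convolution product of linear maps `H a → R` and `H b → R`, for `a * b = c`. -/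
def conv {a b c : π} (h : a * b = c) (f : H a →ₗ[k] R) (g : H b →ₗ[k] R) : H c →ₗ[k] R :=
  LinearMap.mul' k R ∘ₗ TensorProduct.map f g ∘ₗ (comulOf k H h).toLinearMap

variable (k H R) in
/-- The unit of the convolution product. -/
def convOne : H (1 : π) →ₗ[k] R := Algebra.linearMap k R ∘ₗ (ε (k := k) (H := H)).toLinearMap

lemma conv_eq {a b c : π} (h : a * b = c) (f : H a →ₗ[k] R) (g : H b →ₗ[k] R) (x : H c) :
    conv h f g x = LinearMap.mul' k R (TensorProduct.map f g (comulOf k H h x)) := rfl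

lemma conv_assoc {a b c ab bc abc : π} (h₁ : a * b = ab) (h₂ : ab * c = abc) (h₃ : b * c = bc)
    (h₄ : a * bc = abc) (f : H a →ₗ[k] R) (g : H b →ₗ[k] R) (l : H c →ₗ[k] R) :
    conv h₂ (conv h₁ f g) l = conv h₄ f (conv h₃ g l) := by
  subst h₁ h₂ h₃
  have key := HopfGCoalgebra.coassoc (k := k) (H := H) a b c
  ext x
  have kx := LinearMap.congr_fun key x
  simp only [LinearMap.comp_apply, AlgHom.toLinearMap_apply, LinearEquiv.coe_coe] at kx
  have e1 : ∀ t : H (a * b) ⊗[k] H c,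
      LinearMap.mul' k R (TensorProduct.map (conv (c := a * b) rfl f g) l t) =
        LinearMap.mul' k R (TensorProduct.map f (LinearMap.mul' k R ∘ₗ TensorProduct.map g l)
          (TensorProduct.assoc k (H a) (H b) (H c)
            (TensorProduct.map (Δ (k := k) a b).toLinearMap LinearMap.id t))) := by
    intro t
    induction t with
    | zero => simp
    | add s t hs ht => simp only [map_add, hs, ht]
    | tmul y z =>
      have : comulOf k H (rfl : a * b = a * b) y = Δ a b y := rfl
      simp only [TensorProduct.map_tmul, conv_eq, this, AlgHom.toLinearMap_apply,
        LinearMap.mul'_apply, LinearMap.id_apply]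
      generalize Δ (k := k) a b y = w
      induction w with
      | zero => simp
      | add s t hs ht => simp only [map_add, add_mul, TensorProduct.add_tmul, hs, ht]
      | tmul p q => simp [mul_assoc]
  have e2 : ∀ t : H a ⊗[k] H (b * c),
      LinearMap.mul' k R (TensorProduct.map f (conv (c := b * c) rfl g l) t) =
        LinearMap.mul' k R (TensorProduct.map f (LinearMap.mul' k R ∘ₗ TensorProduct.map g l)
            (TensorProduct.map LinearMap.id (Δ (k := k) b c).toLinearMap t)) := by
    intro t
    induction t with
    | zero => simp
    | add s t hs ht => simp only [map_add, hs, ht]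
    | tmul y z => rfl
  rw [conv_eq, conv_eq, e1, e2]
  congr 2

lemma conv_one {a : π} (h : a * 1 = a) (f : H a →ₗ[k] R) : conv h f (convOne k H R) = f := by
  ext x
  have kx := LinearMap.congr_fun (HopfGCoalgebra.counit_right (k := k) (H := H) a) x
  have e : ∀ t : H a ⊗[k] H (1 : π),
      LinearMap.mul' k R (TensorProduct.map f (convOne k H R) t) =
        f (TensorProduct.rid k (H a) (TensorProduct.map LinearMap.id
          (ε (k := k) (H := H)).toLinearMap t)) := by
    intro t
    induction t with
    | zero => simp
    | add s t hs ht => simp only [map_add, hs, ht]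
    | tmul y z =>
      simp [convOne, ← Algebra.commutes, ← Algebra.smul_def]
  rw [conv_eq, e]
  exact congrArg f kx

lemma one_conv {a : π} (h : 1 * a = a) (f : H a →ₗ[k] R) : conv h (convOne k H R) f = f := by
  ext x
  have kx := LinearMap.congr_fun (HopfGCoalgebra.counit_left (k := k) (H := H) a) x
  have e : ∀ t : H (1 : π) ⊗[k] H a,
      LinearMap.mul' k R (TensorProduct.map (convOne k H R) f t) =
        f (TensorProduct.lid k (H a) (TensorProduct.map
          (ε (k := k) (H := H)).toLinearMap LinearMap.id t)) := by
    intro t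
    induction t with
    | zero => simp
    | add s t hs ht => simp only [map_add, hs, ht]
    | tmul y z =>
      simp [convOne, ← Algebra.smul_def]
  rw [conv_eq, e]
  exact congrArg f kx

lemma antipodeOf_conv_id {a b : π} (h : a * b = 1) :
    conv h (antipodeOf k H h) LinearMap.id = convOne k H (H b) := by
  obtain rfl : a = b⁻¹ := eq_inv_of_mul_eq_one_left h
  ext x
  have kx := LinearMap.congr_fun (HopfGCoalgebra.antipode_left (k := k) (H := H) b)
    (gcast k H h.symm x)
  simp only [LinearMap.comp_apply, AlgEquiv.toLinearMap_apply, gcast_gcast_symm] at kx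
  exact kx

lemma id_conv_antipodeOf {a b : π} (h : a * b = 1) (h' : b * a = 1) :
    conv h' LinearMap.id (antipodeOf k H h) = convOne k H (H b) := by
  obtain rfl : a = b⁻¹ := eq_inv_of_mul_eq_one_left h
  ext x
  have kx := LinearMap.congr_fun (HopfGCoalgebra.antipode_right (k := k) (H := H) b)
    (gcast k H h'.symm x)
  simp only [LinearMap.comp_apply, AlgEquiv.toLinearMap_apply, gcast_gcast_symm] at kx
  exact kx

lemma algHom_comp_conv {a b c : π} (h : a * b = c) (φ : R →ₐ[k] R') (f : H a →ₗ[k] R)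
    (g : H b →ₗ[k] R) :
    φ.toLinearMap ∘ₗ conv h f g = conv h (φ.toLinearMap ∘ₗ f) (φ.toLinearMap ∘ₗ g) := by
  ext x
  simp only [LinearMap.comp_apply, conv_eq]
  generalize comulOf k H h x = t
  induction t with
  | zero => simp
  | add s t hs ht => simp only [map_add, hs, ht]
  | tmul y z => simp

lemma algHom_comp_convOne (φ : R →ₐ[k] R') :
    φ.toLinearMap ∘ₗ convOne k H R = convOne k H R' := by
  ext x
  simp [convOne]

variable (k H) in
/-- The inclusion of the left tensor factor. -/
def inclL (c d : π) : H c →ₐ[k] H c ⊗[k] H d := Algebra.TensorProduct.includeLeft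

variable (k H) in
/-- The inclusion of the right tensor factor. -/
def inclR (c d : π) : H d →ₐ[k] H c ⊗[k] H d := Algebra.TensorProduct.includeRight

lemma comulOf_eq_conv {c d f : π} (h : c * d = f) :
    (comulOf k H h).toLinearMap =
      conv h (inclL k H c d).toLinearMap (inclR k H c d).toLinearMap := by
  ext x
  simp only [conv_eq, AlgHom.toLinearMap_apply]
  generalize comulOf k H h x = t
  induction t with
  | zero => simp
  | add s t hs ht => simp only [map_add, ← hs, ← ht]
  | tmul y z => simp [inclL, inclR]

/-- `Δ(S(h₁)) (h₂ ⊗ 1) = 1 ⊗ S(h)`. -/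
lemma comulOf_antipodeOf_conv_inclL {c d e f p : π} (hp : p * c = e) (hpf : p * f = 1)
    (hf : c * d = f) (he : e * d = 1) :
    conv hp ((comulOf k H hf).toLinearMap ∘ₗ antipodeOf k H hpf) (inclL k H c d).toLinearMap =
      (inclR k H c d).toLinearMap ∘ₗ antipodeOf k H he := by
  have hde : d * e = 1 := mul_eq_one_comm.mp he
  have hfe : f * e = c := by rw [← hf, mul_assoc, hde, mul_one]
  have h1 : conv hpf ((comulOf k H hf).toLinearMap ∘ₗ antipodeOf k H hpf)
      (comulOf k H hf).toLinearMap = convOne k H _ := by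
    have := algHom_comp_conv hpf (comulOf k H hf) (antipodeOf k H hpf) LinearMap.id
    rw [antipodeOf_conv_id, algHom_comp_convOne, LinearMap.comp_id] at this
    exact this.symm
  have h2 : conv hfe (comulOf k H hf).toLinearMap
      ((inclR k H c d).toLinearMap ∘ₗ antipodeOf k H he) = (inclL k H c d).toLinearMap := by
    have := algHom_comp_conv hde (inclR k H c d) LinearMap.id (antipodeOf k H he)
    rw [id_conv_antipodeOf he hde, algHom_comp_convOne, LinearMap.comp_id] at this
    rw [comulOf_eq_conv, conv_assoc hf hfe hde (mul_one c), ← this, conv_one]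
  rw [← h2, ← conv_assoc hpf (one_mul e) hfe hp, h1, one_conv]

/-- The antipode reverses the comultiplication: `Δ(S(h)) = S(h₂) ⊗ S(h₁)`. -/
lemma comulOf_comp_antipodeOf {c d e f g p : π} (hpf : p * f = 1) (hf : c * d = f)
    (he : e * d = 1) (hg : g * c = 1) (hp : e * g = p) :
    (comulOf k H hf).toLinearMap ∘ₗ antipodeOf k H hpf =
      conv hp ((inclR k H c d).toLinearMap ∘ₗ antipodeOf k H he)
        ((inclL k H c d).toLinearMap ∘ₗ antipodeOf k H hg) := by
  have hcg : c * g = 1 := mul_eq_one_comm.mp hg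
  have hpc : p * c = e := by rw [← hp, mul_assoc, hg, mul_one]
  have h1 := algHom_comp_conv hcg (inclL k H c d) LinearMap.id (antipodeOf k H hg)
  rw [id_conv_antipodeOf hg hcg, algHom_comp_convOne, LinearMap.comp_id] at h1
  rw [← comulOf_antipodeOf_conv_inclL hpc hpf hf he, conv_assoc hpc hp hcg (mul_one p), ← h1,
    conv_one]

/-- `Δ(S(h)) = S(h₂) ⊗ S(h₁)`, elementwise. -/
lemma comulOf_antipodeOf {c d e f g p : π} (hpf : p * f = 1) (hf : c * d = f)
    (he : e * d = 1) (hg : g * c = 1) (hp : e * g = p) (x : H p) :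
    comulOf k H hf (antipodeOf k H hpf x) =
      TensorProduct.comm k (H d) (H c)
        (TensorProduct.map (antipodeOf k H he) (antipodeOf k H hg) (comulOf k H hp x)) := by
  have := LinearMap.congr_fun (comulOf_comp_antipodeOf (k := k) (H := H) hpf hf he hg hp) x
  rw [LinearMap.comp_apply, AlgHom.toLinearMap_apply, conv_eq] at this
  rw [this]
  generalize comulOf k H hp x = t
  induction t with
  | zero => simp
  | add s t hs ht => simp only [map_add, hs, ht]
  | tmul y z => simp [inclL, inclR]

lemma counit_antipodeOf (y : H (1 : π)) :
    ε (k := k) (antipodeOf k H (one_mul (1 : π)) y) = ε (k := k) y := by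
  have h := algHom_comp_conv (one_mul (1 : π)) (ε (k := k) (H := H))
    (antipodeOf k H (one_mul (1 : π))) LinearMap.id
  have e : (ε (k := k) (H := H)).toLinearMap ∘ₗ LinearMap.id = convOne k H k := by
    ext x; simp [convOne]
  rw [antipodeOf_conv_id, algHom_comp_convOne, e, conv_one] at h
  simpa [convOne] using (LinearMap.congr_fun h y).symm

end Convolution

section PartialTrace

variable {k : Type*} [Field k] {C V : Type*} [Ring C] [Algebra k C] [AddCommGroup V] [Module k V]
  [FiniteDimensional k V]

variable (k C V) in
/-- The partial trace of a linear map `V → C ⊗ V`. -/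
def partialTrace : (V →ₗ[k] C ⊗[k] V) →ₗ[k] C :=
  ∑ i, (TensorProduct.rid k C).toLinearMap ∘ₗ
    TensorProduct.map LinearMap.id ((Module.finBasis k V).coord i) ∘ₗ
      LinearMap.applyₗ (Module.finBasis k V i)

lemma partialTrace_apply (G : V →ₗ[k] C ⊗[k] V) :
    partialTrace k C V G = ∑ i, TensorProduct.rid k C
      (TensorProduct.map LinearMap.id ((Module.finBasis k V).coord i)
        (G (Module.finBasis k V i))) := by
  simp [partialTrace]

lemma trace_eq_sum_coord (T : V →ₗ[k] V) :
    LinearMap.trace k V T =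
      ∑ i, (Module.finBasis k V).coord i (T (Module.finBasis k V i)) := by
  rw [LinearMap.trace_eq_matrix_trace k (Module.finBasis k V), Matrix.trace]
  simp [LinearMap.toMatrix_apply]

/-- The partial trace of `v ↦ c ⊗ T v` is `tr(T) c`. -/
lemma partialTrace_mk_comp (c : C) (T : V →ₗ[k] V) :
    partialTrace k C V (TensorProduct.mk k C V c ∘ₗ T) = LinearMap.trace k V T • c := by
  rw [partialTrace_apply, trace_eq_sum_coord, Finset.sum_smul]
  simp

/-- The partial trace of `v ↦ f v ⊗ d` is `f d`. -/
lemma partialTrace_flip_mk_comp (d : V) (f : V →ₗ[k] C) :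
    partialTrace k C V ((TensorProduct.mk k C V).flip d ∘ₗ f) = f d := by
  rw [partialTrace_apply]
  conv_rhs => rw [← (Module.finBasis k V).sum_repr d, map_sum]
  simp

/-- A tensor all of whose left slices lie in a submodule `N` is killed by every linear map
vanishing on `N ⊗ W`. -/
lemma map_eq_zero_of_slices {U W X : Type*} [AddCommGroup U] [Module k U] [AddCommGroup W]
    [Module k W] [FiniteDimensional k W] [AddCommGroup X] [Module k X] (N : Submodule k U)
    (q : U ⊗[k] W →ₗ[k] X) (hq : ∀ u ∈ N, ∀ w, q (u ⊗ₜ w) = 0) (t : U ⊗[k] W)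
    (ht : ∀ g : W →ₗ[k] k, TensorProduct.rid k U (TensorProduct.map LinearMap.id g t) ∈ N) :
    q t = 0 := by
  let b := Module.finBasis k W
  have key : t = ∑ i, TensorProduct.rid k U
      (TensorProduct.map LinearMap.id (b.coord i) t) ⊗ₜ[k] b i := by
    clear ht
    induction t with
    | zero => simp
    | add s t hs ht =>
      simp only [map_add, TensorProduct.add_tmul, Finset.sum_add_distrib, ← hs, ← ht]
    | tmul u w =>
      conv_lhs => rw [← b.sum_repr w, TensorProduct.tmul_sum]
      simp [TensorProduct.smul_tmul]
  rw [key, map_sum]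
  exact Finset.sum_eq_zero fun i _ => hq _ (ht _) _

end PartialTrace

section Integral

variable {k : Type*} [Field k] {π : Type*} [Group π] {H : π → Type*}
  [∀ α, Ring (H α)] [∀ α, Algebra k (H α)] [HopfGCoalgebra k H]

/-- The operator `y ↦ y₁ m(y₂)` on `H a` given by a functional `m` on `H 1`. -/
def dualAct (m : H (1 : π) →ₗ[k] k) (a : π) : H a →ₗ[k] H a :=
  conv (mul_one a) LinearMap.id (Algebra.linearMap k (H a) ∘ₗ m)

/-- The operator `H d → H c ⊗ H d`, `a ↦ Δ(Φ(a₂)) (S(a₁) ⊗ 1)`. -/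
def twist {c d : π} (hcd : c * d = 1) (hdc : d * c = 1) (Φ : H (1 : π) →ₗ[k] H (1 : π)) :
    H d →ₗ[k] H c ⊗[k] H d :=
  LinearMap.mul' k _ ∘ₗ (TensorProduct.comm k _ _).toLinearMap ∘ₗ
    TensorProduct.map ((inclL k H c d).toLinearMap ∘ₗ antipodeOf k H hdc)
      ((comulOf k H hcd).toLinearMap ∘ₗ Φ) ∘ₗ (comulOf k H (mul_one d)).toLinearMap

lemma twist_apply {c d : π} (hcd : c * d = 1) (hdc : d * c = 1)
    (Φ : H (1 : π) →ₗ[k] H (1 : π)) (a : H d) :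
    twist hcd hdc Φ a = LinearMap.mul' k _ (TensorProduct.comm k _ _
      (TensorProduct.map ((inclL k H c d).toLinearMap ∘ₗ antipodeOf k H hdc)
        ((comulOf k H hcd).toLinearMap ∘ₗ Φ) (comulOf k H (mul_one d) a))) := rfl

/-- `Δ(S²(a₂)) (S(a₁) ⊗ 1) = 1 ⊗ S²(a)`. -/
lemma twist_antipodeOf_sq {c d : π} (hcd : c * d = 1) (hdc : d * c = 1) (a : H d) :
    twist hcd hdc (antipodeOf k H (one_mul 1) ∘ₗ antipodeOf k H (one_mul 1)) a =
      inclR k H c d (antipodeOf k H hcd (antipodeOf k H hdc a)) := by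
  have h1 := LinearMap.congr_fun (comulOf_antipodeOf_conv_inclL (k := k) (H := H)
    (one_mul c) (one_mul 1) hcd hcd) (antipodeOf k H hdc a)
  rw [conv_eq, comulOf_antipodeOf hdc (one_mul c) hdc (one_mul 1) (mul_one d)] at h1
  rw [LinearMap.comp_apply, AlgHom.toLinearMap_apply] at h1
  rw [← h1, twist_apply]
  generalize comulOf k H (mul_one d) a = t
  induction t with
  | zero => simp
  | add s t hs ht => simp only [map_add, hs, ht]
  | tmul y z => simp

lemma twist_mulLeft_comp {c d : π} (hcd : c * d = 1) (hdc : d * c = 1)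
    (Φ : H (1 : π) →ₗ[k] H (1 : π)) (x : H (1 : π)) (a : H d) :
    twist hcd hdc (LinearMap.mulLeft k x ∘ₗ Φ) a = comulOf k H hcd x * twist hcd hdc Φ a := by
  rw [twist_apply, twist_apply]
  generalize comulOf k H (mul_one d) a = t
  induction t with
  | zero => simp
  | add s t hs ht => simp only [map_add, hs, ht, mul_add]
  | tmul y z => simp [mul_assoc]

/-- `Δ(y₁ m(y₂)) = y₁ ⊗ y₂ m(y₃)`. -/
lemma comulOf_dualAct (m : H (1 : π) →ₗ[k] k) {c d f : π} (hf : c * d = f) (y : H f) :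
    comulOf k H hf (dualAct m f y) =
      TensorProduct.map LinearMap.id (dualAct m d) (comulOf k H hf y) := by
  have e (φ : H f →ₐ[k] H c ⊗[k] H d) : φ.toLinearMap ∘ₗ Algebra.linearMap k (H f) ∘ₗ m =
      Algebra.linearMap k (H c ⊗[k] H d) ∘ₗ m := by ext; simp
  have e' (φ : H d →ₐ[k] H c ⊗[k] H d) : φ.toLinearMap ∘ₗ Algebra.linearMap k (H d) ∘ₗ m =
      Algebra.linearMap k (H c ⊗[k] H d) ∘ₗ m := by ext; simp
  have h1 := algHom_comp_conv (mul_one f) (comulOf k H hf) LinearMap.id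
    (Algebra.linearMap k (H f) ∘ₗ m)
  have h2 := algHom_comp_conv (mul_one d) (inclR k H c d) LinearMap.id
    (Algebra.linearMap k (H d) ∘ₗ m)
  rw [LinearMap.comp_id, e'] at h2
  rw [LinearMap.comp_id, e, comulOf_eq_conv, conv_assoc hf (mul_one f) (mul_one d) hf, ← h2,
    ← comulOf_eq_conv] at h1
  have h3 := LinearMap.congr_fun h1 y
  refine h3.trans ?_
  rw [conv_eq]
  generalize comulOf k H hf y = t
  induction t with
  | zero => simp
  | add s t hs ht => simp only [map_add, hs, ht]
  | tmul y z => simp [dualAct, inclL, inclR]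

lemma twist_dualAct_comp {c d : π} (hcd : c * d = 1) (hdc : d * c = 1)
    (m Φ) (a : H d) :
    twist (k := k) (H := H) hcd hdc (dualAct m 1 ∘ₗ Φ) a =
      TensorProduct.map LinearMap.id (dualAct m d) (twist hcd hdc Φ a) := by
  rw [twist_apply, twist_apply]
  generalize comulOf k H (mul_one d) a = t
  induction t with
  | zero => simp
  | add s t hs ht => simp only [map_add, hs, ht]
  | tmul y z =>
    simp only [TensorProduct.map_tmul, TensorProduct.comm_tmul, LinearMap.mul'_apply,
      LinearMap.comp_apply, AlgHom.toLinearMap_apply, comulOf_dualAct]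
    generalize comulOf k H hcd (Φ z) = w
    induction w with
    | zero => simp
    | add s t hs ht => simp only [map_add, add_mul, hs, ht]
    | tmul p q => simp [inclL]

variable (k H) in
/-- The square of the antipode of `H a`. -/
def antipodeOfSq (a : π) : H a →ₗ[k] H a :=
  antipodeOf k H (inv_mul_cancel a) ∘ₗ antipodeOf k H (mul_inv_cancel a)

/-- The functional `x ↦ tr(y ↦ x₁ S²(y₁) m(x₂ S²(y₂)))` on `H a`. -/
def traceIntegral (m : H (1 : π) →ₗ[k] k) (a : π) : H a →ₗ[k] k :=
  LinearMap.trace k (H a) ∘ₗ LinearMap.compRight k (dualAct m a) ∘ₗ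
    LinearMap.lcomp k (H a) (antipodeOfSq k H a) ∘ₗ LinearMap.mul k (H a)

lemma antipodeOfSq_eq {c d : π} (hcd : c * d = 1) (hdc : d * c = 1) :
    antipodeOfSq k H d = antipodeOf k H hcd ∘ₗ antipodeOf k H hdc := by
  obtain rfl : c = d⁻¹ := eq_inv_of_mul_eq_one_left hcd
  rfl

lemma traceIntegral_apply (m : H (1 : π) →ₗ[k] k) (a : π) (x : H a) :
    traceIntegral m a x =
      LinearMap.trace k (H a) (dualAct m a ∘ₗ LinearMap.mulLeft k x ∘ₗ antipodeOfSq k H a) := rfl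

/-- `S(y₂) S²(y₁) = ε(y) 1` on `H 1`. -/
lemma antipodeOf_mul_antipodeOfSq (y : H (1 : π)) :
    LinearMap.mul' k (H (1 : π)) (TensorProduct.comm k _ _
      (TensorProduct.map (antipodeOfSq k H 1) (antipodeOf k H (one_mul 1))
        (comulOf k H (mul_one 1) y))) = algebraMap k _ (ε (k := k) y) := by
  have h := LinearMap.congr_fun (id_conv_antipodeOf (k := k) (H := H) (one_mul 1) (one_mul 1))
    (antipodeOf k H (one_mul 1) y)
  rw [conv_eq, comulOf_antipodeOf (one_mul 1) (one_mul 1) (one_mul 1) (one_mul 1) (mul_one 1)] at h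
  have h' : convOne k H (H 1) (antipodeOf k H (one_mul 1) y) = algebraMap k _ (ε (k := k) y) := by
    simp [convOne, counit_antipodeOf]
  rw [← h', ← h, antipodeOfSq_eq (one_mul 1) (one_mul 1)]
  generalize comulOf k H (mul_one 1) y = t
  induction t with
  | zero => simp
  | add s t hs ht => simp only [map_add, hs, ht]
  | tmul y z => simp

/-- `S²(y₂) S(y₁) = ε(y) 1` on `H 1`. -/
lemma antipodeOfSq_mul_antipodeOf (y : H (1 : π)) :
    LinearMap.mul' k (H (1 : π)) (TensorProduct.comm k _ _
      (TensorProduct.map (antipodeOf k H (one_mul 1)) (antipodeOfSq k H 1)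
        (comulOf k H (one_mul 1) y))) = algebraMap k _ (ε (k := k) y) := by
  have h := LinearMap.congr_fun (antipodeOf_conv_id (k := k) (H := H) (one_mul 1))
    (antipodeOf k H (one_mul 1) y)
  rw [conv_eq, comulOf_antipodeOf (one_mul 1) (one_mul 1) (one_mul 1) (one_mul 1) (mul_one 1)] at h
  have h' : convOne k H (H 1) (antipodeOf k H (one_mul 1) y) = algebraMap k _ (ε (k := k) y) := by
    simp [convOne, counit_antipodeOf]
  rw [← h', ← h, antipodeOfSq_eq (one_mul 1) (one_mul 1)]
  generalize comulOf k H (mul_one 1) y = t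
  induction t with
  | zero => simp
  | add s t hs ht => simp only [map_add, hs, ht]
  | tmul y z => simp

variable [∀ α, FiniteDimensional k (H α)]

lemma partialTrace_twist {c d : π} (hcd : c * d = 1) (hdc : d * c = 1)
    (Φ : H (1 : π) →ₗ[k] H (1 : π)) :
    partialTrace k (H c) (H d) (twist hcd hdc Φ) = LinearMap.trace k _ Φ • 1 := by
  have hΦ : Φ = ∑ i, LinearMap.smulRight ((Module.finBasis k (H (1 : π))).coord i)
      (Φ (Module.finBasis k (H (1 : π)) i)) := by
    ext y
    conv_lhs => rw [← (Module.finBasis k (H (1 : π))).sum_repr y, map_sum]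
    simp
  have twist_add (Φ Ψ) : twist (k := k) (H := H) hcd hdc (Φ + Ψ) =
      twist hcd hdc Φ + twist hcd hdc Ψ := by
    simp only [twist, LinearMap.comp_add, LinearMap.add_comp, TensorProduct.map_add_right]
  have twist_sum (s : Finset (Fin (Module.finrank k (H (1 : π)))))
      (F : Fin (Module.finrank k (H (1 : π))) → H (1 : π) →ₗ[k] H (1 : π)) :
      twist (k := k) (H := H) hcd hdc (∑ i ∈ s, F i) = ∑ i ∈ s, twist hcd hdc (F i) :=
    map_sum (AddMonoidHom.mk' (twist (k := k) (H := H) hcd hdc) twist_add) F s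
  have rank_one (φ : H (1 : π) →ₗ[k] k) (b : H (1 : π)) :
      partialTrace k (H c) (H d) (twist hcd hdc (φ.smulRight b)) = φ b • 1 := by
    set f : H d →ₗ[k] H c := conv (mul_one d) (antipodeOf k H hdc)
      (Algebra.linearMap k (H c) ∘ₗ φ) with hf
    have h1 : ∀ a, twist hcd hdc (φ.smulRight b) a =
        comulOf k H hcd b * inclL k H c d (f a) := by
      intro a
      rw [twist_apply, hf, conv_eq]
      generalize comulOf k H (mul_one d) a = t
      induction t with
      | zero => simp
      | add s t hs ht => simp only [map_add, hs, ht, mul_add]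
      | tmul y z =>
        simp [← Algebra.commutes, ← Algebra.smul_def]
    have h2 : ∀ (w : H c ⊗[k] H d) (G : H d →ₗ[k] H c ⊗[k] H d),
        (∀ a, G a = w * inclL k H c d (f a)) →
        partialTrace k (H c) (H d) G =
          LinearMap.mul' k _ (TensorProduct.map LinearMap.id f w) := by
      intro w
      induction w with
      | zero =>
        intro G hG
        obtain rfl : G = 0 := by ext a; simp [hG]
        simp
      | add s t hs ht =>
        intro G hG
        have : G = LinearMap.mulLeft k s ∘ₗ (inclL k H c d).toLinearMap ∘ₗ f +
            LinearMap.mulLeft k t ∘ₗ (inclL k H c d).toLinearMap ∘ₗ f := by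
          ext a; simp [hG, add_mul]
        rw [this, map_add, hs _ fun a => rfl, ht _ fun a => rfl, map_add, map_add]
      | tmul p q =>
        intro G hG
        have : G = (TensorProduct.mk k (H c) (H d)).flip q ∘ₗ LinearMap.mulLeft k p ∘ₗ f := by
          ext a; simp [hG, inclL]
        rw [this, partialTrace_flip_mk_comp]
        simp
    rw [h2 _ _ h1, ← conv_eq, hf, ← conv_assoc hcd (one_mul 1) (mul_one d) hcd,
      id_conv_antipodeOf hdc hcd, one_conv]
    simp [Algebra.algebraMap_eq_smul_one]
  rw [hΦ, twist_sum, map_sum, map_sum, Finset.sum_smul]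
  refine Finset.sum_congr rfl fun i _ => ?_
  rw [rank_one, LinearMap.trace_smulRight]

/-- The functionals `traceIntegral m` form a left integral: `x₁ μ(x₂) = λ(x) 1`. -/
lemma comulOf_traceIntegral (m : H (1 : π) →ₗ[k] k) {c d : π} (hcd : c * d = 1)
    (hdc : d * c = 1) (x : H (1 : π)) :
    TensorProduct.rid k (H c) (TensorProduct.map LinearMap.id (traceIntegral m d)
      (comulOf k H hcd x)) = traceIntegral m 1 x • 1 := by
  rw [traceIntegral_apply, ← partialTrace_twist hcd hdc]
  have h1 : ∀ a, twist hcd hdc (dualAct m 1 ∘ₗ LinearMap.mulLeft k x ∘ₗ antipodeOfSq k H 1) a =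
      TensorProduct.map LinearMap.id (dualAct m d)
        (comulOf k H hcd x * inclR k H c d (antipodeOfSq k H d a)) := by
    intro a
    rw [twist_dualAct_comp, twist_mulLeft_comp, antipodeOfSq_eq (one_mul 1) (one_mul 1),
      twist_antipodeOf_sq, antipodeOfSq_eq hcd hdc, LinearMap.comp_apply]
  have h2 : ∀ (w : H c ⊗[k] H d) (G : H d →ₗ[k] H c ⊗[k] H d),
      (∀ a, G a = TensorProduct.map LinearMap.id (dualAct m d)
        (w * inclR k H c d (antipodeOfSq k H d a))) →
      partialTrace k (H c) (H d) G =
        TensorProduct.rid k (H c) (TensorProduct.map LinearMap.id (traceIntegral m d) w) := by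
    intro w
    induction w with
    | zero =>
      intro G hG
      obtain rfl : G = 0 := by ext a; simp [hG]
      simp
    | add s t hs ht =>
      intro G hG
      have : G = TensorProduct.map LinearMap.id (dualAct m d) ∘ₗ LinearMap.mulLeft k s ∘ₗ
            (inclR k H c d).toLinearMap ∘ₗ antipodeOfSq k H d +
          TensorProduct.map LinearMap.id (dualAct m d) ∘ₗ LinearMap.mulLeft k t ∘ₗ
            (inclR k H c d).toLinearMap ∘ₗ antipodeOfSq k H d := by
        ext a; simp [hG, add_mul]
      rw [this, map_add, hs _ fun a => rfl, ht _ fun a => rfl, map_add, map_add]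
    | tmul p q =>
      intro G hG
      have : G = TensorProduct.mk k (H c) (H d) p ∘ₗ
          (dualAct m d ∘ₗ LinearMap.mulLeft k q ∘ₗ antipodeOfSq k H d) := by
        ext a; simp [hG, inclR]
      rw [this, partialTrace_mk_comp]
      simp [traceIntegral_apply]
  exact (h2 _ _ h1).symm

variable (k H) in
lemma exists_traceIntegral_ne_zero :
    ∃ m : H (1 : π) →ₗ[k] k, traceIntegral m (1 : π) ≠ 0 := by
  by_contra! hzero
  let b := Module.finBasis k (H (1 : π))
  have h1 : ∑ i, LinearMap.mulLeft k (antipodeOf k H (one_mul 1) (b i)) ∘ₗ antipodeOfSq k H 1 ∘ₗ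
      dualAct (b.coord i) 1 = LinearMap.smulRight (ε (k := k) (H := H)).toLinearMap 1 := by
    ext y
    have hy := antipodeOf_mul_antipodeOfSq (k := k) y
    rw [Algebra.algebraMap_eq_smul_one] at hy
    refine Eq.trans ?_ hy
    simp only [LinearMap.sum_apply, LinearMap.comp_apply, dualAct, conv_eq]
    generalize comulOf k H (mul_one 1) y = t
    induction t with
    | zero => simp
    | add s t hs ht => simp only [map_add, Finset.sum_add_distrib, hs, ht]
    | tmul y z =>
      conv_rhs => rw [← b.sum_repr z]
      simp only [map_sum, TensorProduct.tmul_sum]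
      simp [← Algebra.commutes, ← Algebra.smul_def]
  have h2 : LinearMap.trace k (H (1 : π))
      (LinearMap.smulRight (ε (k := k) (H := H)).toLinearMap 1) = 0 := by
    rw [← h1, map_sum]
    refine Finset.sum_eq_zero fun i _ => ?_
    rw [← LinearMap.comp_assoc, LinearMap.trace_comp_comm', ← traceIntegral_apply, hzero,
      LinearMap.zero_apply]
  rw [LinearMap.trace_smulRight] at h2
  simp at h2

/-- If `μ(z S(h)) = 0` for all `z`, then `λ(x S(h₁)) h₂ = 0` for all `x`. -/
lemma traceIntegral_slice (m : H (1 : π) →ₗ[k] k) {c d : π} (hcd : c * d = 1) (hdc : d * c = 1)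
    (h : H c) (hh : ∀ z, traceIntegral m d (z * antipodeOf k H hcd h) = 0) (x : H (1 : π)) :
    TensorProduct.lid k (H c) (TensorProduct.map
      (traceIntegral m 1 ∘ₗ LinearMap.mulLeft k x ∘ₗ antipodeOf k H (one_mul 1)) LinearMap.id
      (comulOf k H (one_mul c) h)) = 0 := by
  have h1 := LinearMap.congr_fun (comulOf_antipodeOf_conv_inclL (k := k) (H := H)
    (one_mul c) (one_mul 1) hcd hcd) h
  have h2 := congrArg (fun w => TensorProduct.rid k (H c) (TensorProduct.map LinearMap.id
    (traceIntegral m d) (comulOf k H hcd x * w))) h1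
  have h3 : TensorProduct.rid k (H c) (TensorProduct.map LinearMap.id
      (traceIntegral m d) (comulOf k H hcd x * inclR k H c d (antipodeOf k H hcd h))) = 0 := by
    generalize comulOf k H hcd x = t
    induction t with
    | zero => simp
    | add s t hs ht => simp only [map_add, add_mul, hs, ht, add_zero]
    | tmul y z => simp [inclR, hh]
  refine Eq.trans ?_ (h2.trans h3)
  rw [conv_eq]
  generalize comulOf k H (one_mul c) h = t
  induction t with
  | zero => simp
  | add s t hs ht => simp only [map_add, mul_add, hs, ht]
  | tmul y z =>
    have h4 : ∀ w : H c ⊗[k] H d, TensorProduct.rid k (H c) (TensorProduct.map LinearMap.id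
        (traceIntegral m d) (w * inclL k H c d z)) =
        TensorProduct.rid k (H c) (TensorProduct.map LinearMap.id (traceIntegral m d) w) * z := by
      intro w
      induction w with
      | zero => simp
      | add s t hs ht => simp only [map_add, add_mul, hs, ht]
      | tmul p q => simp [inclL]
    simp only [TensorProduct.map_tmul, LinearMap.mul'_apply, AlgHom.toLinearMap_apply,
      LinearMap.comp_apply]
    rw [← mul_assoc, ← map_mul, h4, comulOf_traceIntegral m hcd hdc]
    simp

/-- The functional of `traceIntegral_slice`, evaluated by a functional on the second factor. -/
lemma traceIntegral_mul_antipodeOf_slice (m : H (1 : π) →ₗ[k] k) {c d : π} (hcd : c * d = 1)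
    (hdc : d * c = 1) (h : H c) (hh : ∀ z, traceIntegral m d (z * antipodeOf k H hcd h) = 0)
    (g : H c →ₗ[k] k) (x : H (1 : π)) :
    traceIntegral m 1 (x * antipodeOf k H (one_mul 1) (TensorProduct.rid k (H 1)
      (TensorProduct.map LinearMap.id g (comulOf k H (one_mul c) h)))) = 0 := by
  have := congrArg g (traceIntegral_slice m hcd hdc h hh x)
  rw [map_zero] at this
  rw [← this]
  generalize comulOf k H (one_mul c) h = t
  induction t with
  | zero => simp
  | add s t hs ht => simp only [map_add, mul_add, hs, ht]
  | tmul y z => simp [mul_comm]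

variable (k H) in
/-- The elements `y` of `H 1` with `λ(x S(y)) = 0` for all `x`. -/
def traceRadical (m : H (1 : π) →ₗ[k] k) : Submodule k (H (1 : π)) where
  carrier := {y | ∀ x, traceIntegral m 1 (x * antipodeOf k H (one_mul 1) y) = 0}
  add_mem' hy hz x := by simp [mul_add, hy x, hz x]
  zero_mem' x := by simp
  smul_mem' r y hy x := by simp [hy x]

lemma counit_eq_zero_of_mem_traceRadical {m : H (1 : π) →ₗ[k] k}
    (hm : traceIntegral m (1 : π) ≠ 0) {y : H (1 : π)} (hy : y ∈ traceRadical k H m) :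
    ε (k := k) y = 0 := by
  obtain ⟨x, hx⟩ := DFunLike.ne_iff.mp hm
  have h := map_eq_zero_of_slices (traceRadical k H m)
    (traceIntegral m 1 ∘ₗ LinearMap.mulLeft k x ∘ₗ LinearMap.mul' k (H (1 : π)) ∘ₗ
      (TensorProduct.comm k _ _).toLinearMap ∘ₗ
      TensorProduct.map (antipodeOf k H (one_mul 1)) (antipodeOfSq k H 1))
    (fun u hu w => by
      simpa [mul_assoc] using hu (x * antipodeOfSq k H 1 w))
    (comulOf k H (one_mul 1) y)
    (fun g => traceIntegral_mul_antipodeOf_slice m (one_mul 1) (one_mul 1) y hy g)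
  simp only [LinearMap.comp_apply, LinearEquiv.coe_coe, antipodeOfSq_mul_antipodeOf] at h
  rw [LinearMap.mulLeft_apply, ← Algebra.commutes, ← Algebra.smul_def, map_smul, smul_eq_mul] at h
  exact (mul_eq_zero.mp h).resolve_right hx

variable (k H) in
lemma antipodeOf_injective {c d : π} (hcd : c * d = 1) :
    Function.Injective (antipodeOf k H hcd) := by
  refine (injective_iff_map_eq_zero _).mpr fun h hh => ?_
  obtain ⟨m, hm⟩ := exists_traceIntegral_ne_zero k H
  refine (Module.forall_dual_apply_eq_zero_iff k h).mp fun g => ?_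
  have h1 := counit_eq_zero_of_mem_traceRadical hm
    (traceIntegral_mul_antipodeOf_slice m hcd (mul_eq_one_comm.mp hcd) h (by simp [hh]) g)
  rw [← h1]
  have h2 := LinearMap.congr_fun (one_conv (k := k) (H := H) (one_mul c) g) h
  rw [← h2, conv_eq]
  generalize comulOf k H (one_mul c) h = t
  induction t with
  | zero => simp
  | add s t hs ht => simp only [map_add, hs, ht]
  | tmul y z => simp [convOne, mul_comm]

end Integral

end HopfGCoalgebra

/-- Corollary 3.4(a): the antipode of a finite dimensional Hopf `π`-coalgebra is
bijective. -/
theorem antipode_bijective (k : Type*) [Field k] {π : Type*} [Group π]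
    (H : π → Type*) [∀ α, Ring (H α)] [∀ α, Algebra k (H α)] [HopfGCoalgebra k H]
    [∀ α, FiniteDimensional k (H α)] :
    ∀ α : π, Function.Bijective (antipode k H α) := by
  intro α
  have hinj : Function.Injective (antipode k H α) := antipodeOf_injective k H (mul_inv_cancel α)
  have hdim : Module.finrank k (H α) = Module.finrank k (H α⁻¹) :=
    le_antisymm (LinearMap.finrank_le_finrank_of_injective hinj)
      (LinearMap.finrank_le_finrank_of_injective (antipodeOf_injective k H (inv_mul_cancel α)))
  exact ⟨hinj, (LinearMap.injective_iff_surjective_of_finrank_eq_finrank hdim).mp hinj⟩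
end
end

section
/- Let H be a finite dimensional Hopf π-coalgebra over a field k, let λ = (λ_β)_{β∈π} be a non-zero left π-integral for H, and let α ∈ π with H_α ≠ 0. Then the k-linear map H_α → H_α* sending a ∈ H_α to the form x ↦ λ_α(xa) is bijective. Consequently H_α*, with the left H_α-action (a ⇀ f)(x) = f(xa), is a free left H_α-module of rank 1 with basis vector λ_α (and of rank 0 when H_α = 0). -/
open scoped TensorProduct

noncomputable section

open HopfGCoalgebra
open CrossedHopfGCoalgebra

open QTHopfGCoalgebra

namespace HopfGCoalgebra

section Integrals

variable {k : Type*} [Field k] {π : Type*} {H : π → Type*}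
  [∀ α, Ring (H α)] [∀ α, Algebra k (H α)]

theorem gcast_gcast_cancel {α β : π} (h : α = β) (h' : β = α) (x : H α) :
    gcast k H h' (gcast k H h x) = x := by
  subst h; rfl

theorem form_gcast (lam : ∀ α : π, H α →ₗ[k] k) {α β : π} (h : α = β) (x : H α) :
    lam β (gcast k H h x) = lam α x := by
  subst h; rfl

theorem form_mul_gcast_eq_zero {lam : ∀ α : π, H α →ₗ[k] k} {α β : π} (h : α = β) {a : H α}
    (ha : ∀ x, lam α (x * a) = 0) (x : H β) : lam β (x * gcast k H h a) = 0 := by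
  subst h; exact ha x

variable [Group π] [HopfGCoalgebra k H]

theorem exists_counit_tmul_comul_eq {δ β : π} (hδ : δ = 1) (h : H β) :
    ∃ z : H (δ * β), TensorProduct.map
      ((ε (k := k) (H := H)).toLinearMap ∘ₗ (gcast k H hδ).toLinearMap)
      (LinearMap.id : H β →ₗ[k] H β) (Δ δ β z) = 1 ⊗ₜ[k] h := by
  subst hδ
  refine ⟨gcast k H (one_mul β).symm h, (TensorProduct.lid k (H β)).injective ?_⟩
  exact (LinearMap.congr_fun (counit_left (k := k) (H := H) β) h).trans
    (TensorProduct.lid_tmul h (1 : k) ▸ (one_smul k h).symm)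

/-- If `lam (α * β)` kills the left ideal generated by `a`, then `lam β` kills all `h * a₍₂₎`:
this is `a₍₁₎ λ(h a₍₂₎) = S(h₍₁₎) λ(h₍₂₎ a)`. -/
theorem IsLeftIntegral.comul_eq_zero {lam : ∀ α : π, H α →ₗ[k] k}
    (hint : IsLeftIntegral k H lam) {α β : π} {a : H (α * β)}
    (ha : ∀ x, lam (α * β) (x * a) = 0) (h : H β) :
    TensorProduct.rid k (H α) (TensorProduct.map (LinearMap.id : H α →ₗ[k] H α)
      (lam β ∘ₗ LinearMap.mulLeft k h) (Δ α β a)) = 0 := by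
  let E : H α ⊗[k] H β →ₗ[k] H α :=
    (TensorProduct.rid k (H α)).toLinearMap ∘ₗ
      TensorProduct.map (LinearMap.id : H α →ₗ[k] H α) (lam β) ∘ₗ
      LinearMap.mulRight k (Δ α β a)
  have hE : ∀ x, E (Δ α β x) = 0 := fun x => by
    have := hint α β (x * a)
    rw [ha, zero_smul, map_mul] at this
    exact this
  have hE_smul : ∀ (c x : H α) (y : H β), E ((c * x) ⊗ₜ y) = c * E (x ⊗ₜ y) := by
    intro c x y
    simp only [E, LinearMap.comp_apply, LinearMap.mulRight_apply, LinearEquiv.coe_coe]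
    induction Δ (k := k) α β a using TensorProduct.induction_on with
    | zero => simp
    | tmul p q => simp [mul_assoc]
    | add p q hp hq => simp only [mul_add, map_add, hp, hq]
  let T : H α⁻¹ →ₗ[k] H α := (gcast k H (inv_inv α)).toLinearMap ∘ₗ S α⁻¹
  let F : H α⁻¹ ⊗[k] (H α ⊗[k] H β) →ₗ[k] H α :=
    LinearMap.mul' k (H α) ∘ₗ TensorProduct.map T E
  have hF : F ∘ₗ (TensorProduct.assoc k (H α⁻¹) (H α) (H β)).toLinearMap =
      E ∘ₗ TensorProduct.map (LinearMap.mul' k (H α) ∘ₗ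
        TensorProduct.map T (LinearMap.id : H α →ₗ[k] H α)) LinearMap.id := by
    ext u v y
    simp [F, hE_smul]
  have hFΔ : F ∘ₗ TensorProduct.map LinearMap.id (Δ α β).toLinearMap = 0 := by
    ext u x
    simp [F, hE]
  obtain ⟨z, hz⟩ := exists_counit_tmul_comul_eq (k := k) (H := H) (inv_mul_cancel α) h
  have key := congrArg F (LinearMap.congr_fun (coassoc (k := k) (H := H) α⁻¹ α β) z)
  simp only [LinearMap.comp_apply] at key
  have e1 := fun t => LinearMap.congr_fun hFΔ t
  have e2 := fun t => LinearMap.congr_fun hF t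
  simp only [LinearMap.comp_apply, LinearMap.zero_apply] at e1 e2
  rw [e1, e2, ← LinearMap.comp_apply (TensorProduct.map _ _), ← TensorProduct.map_comp,
    LinearMap.comp_assoc, antipode_left, LinearMap.id_comp] at key
  have hsplit : TensorProduct.map (Algebra.linearMap k (H α) ∘ₗ
      (ε (k := k) (H := H)).toLinearMap ∘ₗ (gcast k H (inv_mul_cancel α)).toLinearMap)
      (LinearMap.id : H β →ₗ[k] H β) =
      TensorProduct.map (Algebra.linearMap k (H α)) LinearMap.id ∘ₗ
      TensorProduct.map ((ε (k := k) (H := H)).toLinearMap ∘ₗ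
        (gcast k H (inv_mul_cancel α)).toLinearMap) LinearMap.id := by
    rw [← TensorProduct.map_comp, LinearMap.id_comp]
  rw [hsplit, LinearMap.comp_apply (TensorProduct.map _ _), AlgHom.toLinearMap_apply, hz,
    TensorProduct.map_tmul, Algebra.linearMap_apply, map_one, LinearMap.id_apply] at key
  rw [← key]
  simp only [E, LinearMap.comp_apply, LinearMap.mulRight_apply, LinearEquiv.coe_coe]
  congr 1
  induction Δ (k := k) α β a using TensorProduct.induction_on with
  | zero => simp
  | tmul p q => simp
  | add p q hp hq => simp only [mul_add, map_add, hp, hq]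

theorem IsLeftIntegral.one_ne_zero {lam : ∀ α : π, H α →ₗ[k] k}
    (hint : IsLeftIntegral k H lam) (hnz : ∃ β : π, lam β ≠ 0) : lam 1 ≠ 0 := by
  rintro h1
  obtain ⟨β, hβ⟩ := hnz
  refine hβ (LinearMap.ext fun x => ?_)
  have := hint β 1 (gcast k H (mul_one β).symm x)
  rw [h1, TensorProduct.map_zero_right, LinearMap.zero_apply, map_zero, form_gcast] at this
  by_contra hx
  have h10 : (1 : H β) = 0 := (smul_eq_zero.mp this.symm).resolve_left hx
  have hx0 : x = 0 := by rw [← mul_one x, h10, mul_zero]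
  exact hx (by rw [hx0, map_zero, map_zero])

theorem IsLeftIntegral.counit_eq_zero [FiniteDimensional k (H 1)]
    {lam : ∀ α : π, H α →ₗ[k] k}
    (hint : IsLeftIntegral k H lam) (hnz : ∃ β : π, lam β ≠ 0) {b : H 1}
    (hb : ∀ x, lam 1 (x * b) = 0) : ε (k := k) b = 0 := by
  have hcast : (1 : π) = 1⁻¹ * 1 := by group
  set b' : H ((1 : π)⁻¹ * 1) := gcast k H hcast b with hb'
  have hzero : ∀ x, lam ((1 : π)⁻¹ * 1) (x * b') = 0 :=
    form_mul_gcast_eq_zero hcast hb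
  obtain ⟨y, hy⟩ : ∃ y, lam 1 y ≠ 0 := by
    by_contra! h
    exact hint.one_ne_zero hnz (LinearMap.ext h)
  let T : H (1 : π)⁻¹ →ₗ[k] H 1 := (gcast k H (inv_inv 1)).toLinearMap ∘ₗ S 1⁻¹
  let e := Module.finBasis k (H (1 : π))
  have hsum : lam 1 ∘ₗ LinearMap.mulLeft k y ∘ₗ LinearMap.mul' k (H 1) ∘ₗ
      TensorProduct.map T LinearMap.id =
      ∑ i, (e.coord i ∘ₗ LinearMap.mulLeft k y ∘ₗ T) ∘ₗ
        (TensorProduct.rid k (H (1 : π)⁻¹)).toLinearMap ∘ₗ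
        TensorProduct.map LinearMap.id (lam 1 ∘ₗ LinearMap.mulLeft k (e i)) := by
    ext u v
    simp only [TensorProduct.AlgebraTensorModule.curry_apply, TensorProduct.curry_apply,
      LinearMap.coe_restrictScalars, LinearMap.comp_apply, TensorProduct.map_tmul,
      LinearMap.id_apply, LinearMap.mul'_apply, LinearMap.mulLeft_apply, LinearMap.sum_apply,
      LinearEquiv.coe_coe, TensorProduct.rid_tmul, map_smul, smul_eq_mul]
    conv_lhs => rw [← mul_assoc, ← e.sum_repr (y * T u), Finset.sum_mul, map_sum]
    refine Finset.sum_congr rfl fun i _ => ?_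
    rw [smul_mul_assoc, map_smul, smul_eq_mul, mul_comm]
    rfl
  have h1 := LinearMap.congr_fun hsum (Δ 1⁻¹ 1 b')
  have h2 := LinearMap.congr_fun (antipode_left (k := k) (H := H) 1) b'
  simp only [LinearMap.comp_apply, LinearMap.sum_apply, LinearEquiv.coe_coe,
    hint.comul_eq_zero hzero, map_zero, Finset.sum_const_zero] at h1
  simp only [LinearMap.comp_apply, AlgHom.toLinearMap_apply] at h2
  rw [h2, AlgEquiv.toLinearMap_apply, hb', gcast_gcast_cancel, Algebra.linearMap_apply,
    LinearMap.mulLeft_apply, ← Algebra.commutes, ← Algebra.smul_def, map_smul, smul_eq_mul] at h1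
  exact (mul_eq_zero.mp h1).resolve_right hy

theorem IsLeftIntegral.eq_zero_of_forall_mul [FiniteDimensional k (H 1)]
    {lam : ∀ α : π, H α →ₗ[k] k}
    (hint : IsLeftIntegral k H lam) (hnz : ∃ β : π, lam β ≠ 0) {α : π} {a : H α}
    (ha : ∀ x, lam α (x * a) = 0) : a = 0 := by
  let e := Module.finBasis k (H (1 : π))
  have hmem : (ε (k := k) (H := H)).toLinearMap ∈ Submodule.span k
      (Set.range fun i => lam 1 ∘ₗ LinearMap.mulLeft k (e i)) := by
    refine mem_span_of_iInf_ker_le_ker fun b hb => ?_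
    simp only [Submodule.mem_iInf, LinearMap.mem_ker] at hb
    refine hint.counit_eq_zero hnz fun x => ?_
    have : lam 1 ∘ₗ LinearMap.mulRight k b = 0 := e.ext hb
    exact LinearMap.congr_fun this x
  have hzero : ∀ x, lam (α * 1) (x * gcast k H (mul_one α).symm a) = 0 :=
    form_mul_gcast_eq_zero _ ha
  have hspan : ∀ f ∈ Submodule.span k
      (Set.range fun i => lam 1 ∘ₗ LinearMap.mulLeft k (e i)),
      TensorProduct.rid k (H α) (TensorProduct.map (LinearMap.id : H α →ₗ[k] H α) f
        (Δ α 1 (gcast k H (mul_one α).symm a))) = 0 := by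
    intro f hf
    induction hf using Submodule.span_induction with
    | mem f hf => obtain ⟨i, rfl⟩ := hf; exact hint.comul_eq_zero hzero _
    | zero => simp
    | add f g _ _ hf hg => rw [TensorProduct.map_add_right, LinearMap.add_apply, map_add, hf, hg,
        add_zero]
    | smul c f _ hf => rw [TensorProduct.map_smul_right, LinearMap.smul_apply, map_smul, hf,
        smul_zero]
  exact (LinearMap.congr_fun (counit_right (k := k) (H := H) α) a).symm.trans (hspan _ hmem)

end Integrals

end HopfGCoalgebra

/-- Corollary 3.4(b): for a non-zero left `π`-integral `λ` and `α` with `H_α ≠ 0`,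
the map `a ↦ (x ↦ λ_α (x a))` is a bijection `H_α → H_α*`; hence `H_α*` is a free
left `H_α`-module of rank 1 with basis vector `λ_α`. -/
theorem dual_free_of_integral (k : Type*) [Field k] {π : Type*} [Group π]
    (H : π → Type*) [∀ α, Ring (H α)] [∀ α, Algebra k (H α)] [HopfGCoalgebra k H]
    [∀ α, FiniteDimensional k (H α)]
    (lam : ∀ α : π, H α →ₗ[k] k) (hint : IsLeftIntegral k H lam)
    (hnz : ∃ β : π, lam β ≠ 0) (α : π) (hα : Nontrivial (H α)) :
    Function.Bijective (fun a : H α => (lam α) ∘ₗ (LinearMap.mulRight k a)) := by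
  let φ : H α →ₗ[k] Module.Dual k (H α) :=
    (LinearMap.mul k (H α)).flip.compr₂ (lam α)
  have hφ : Function.Injective φ := by
    refine (injective_iff_map_eq_zero φ).mpr fun a ha => ?_
    exact hint.eq_zero_of_forall_mul hnz fun x => LinearMap.congr_fun ha x
  exact ⟨hφ, (LinearMap.injective_iff_surjective_of_finrank_eq_finrank
    Subspace.dual_finrank_eq.symm).mp hφ⟩
end
end
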